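/- Let p ≥ 2 be an integer and let q = 3p − 1 (note that p and q are automatically coprime). Then every mass μ on ℝ² admits a (q,p)-spiral equicovering. -/

import Mathlib

open MeasureTheory

noncomputable section

/-- An affine line in the plane. -/
def IsAffineLine (L : Set (ℝ × ℝ)) : Prop :=
  ∃ a b : ℝ × ℝ, b ≠ 0 ∧ L = {x | ∃ t : ℝ, x = a + t • b}

/-- A mass: a Borel probability measure on the plane giving measure zero to every line. -/
def IsMass (μ : Measure (ℝ × ℝ)) : Prop :=
  IsProbabilityMeasure μ ∧ ∀ L : Set (ℝ × ℝ), IsAffineLine L → μ L = 0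

/-- The wedge with apex `O` spanned by angles in `[α, β]`. -/
def Wedge (O : ℝ × ℝ) (α β : ℝ) : Set (ℝ × ℝ) :=
  {O} ∪ {x | ∃ r : ℝ, 0 < r ∧ ∃ θ ∈ Set.Icc α β, x = O + r • (Real.cos θ, Real.sin θ)}

/-- A `(q,p)`-spiral equicovering of the measure `μ`: a point `O` and a weakly increasing
sequence of angles `θ : ℤ → ℝ` with `θ (j+q) = θ j + 2π`, such that every `p`-wedge
`W(O, θ i, θ (i+p))` is convex and has `μ`-measure `p/q`. -/
def IsSpiralEquicovering (μ : Measure (ℝ × ℝ)) (q p : ℕ) : Prop :=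
  ∃ (O : ℝ × ℝ) (θ : ℤ → ℝ),
    (∀ j : ℤ, θ (j + (q : ℤ)) = θ j + 2 * Real.pi) ∧
    (∀ j : ℤ, θ j ≤ θ (j + 1)) ∧
    (∀ i : ℤ, Convex ℝ (Wedge O (θ i) (θ (i + (p : ℤ)))) ∧
      μ (Wedge O (θ i) (θ (i + (p : ℤ)))) = ENNReal.ofReal ((p : ℝ) / (q : ℝ)))

lemma exists_int_abs_sub_lt_of_cos_pos {X : Type*} [TopologicalSpace X] {S : Set X}
    (hS : IsPreconnected S) {D : X → ℝ} (hD : ContinuousOn D S)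
    (hcos : ∀ x ∈ S, 0 < Real.cos (D x)) :
    ∃ n : ℤ, ∀ x ∈ S, |D x - 2 * Real.pi * n| < Real.pi / 2 := by
  have hpi := Real.pi_pos
  rcases S.eq_empty_or_nonempty with rfl | ⟨x₀, hx₀⟩
  · exact ⟨0, by simp⟩
  let n : ℤ := round (D x₀ / (2 * Real.pi))
  have hcosE : ∀ x ∈ S, 0 < Real.cos (D x - 2 * Real.pi * n) := by
    intro x hx
    have h := hcos x hx
    rwa [show 2 * Real.pi * (n : ℝ) = n * (2 * Real.pi) by ring, Real.cos_sub_int_mul_two_pi]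
  have hx₀' : |D x₀ - 2 * Real.pi * n| ≤ Real.pi := by
    have h := abs_sub_round (D x₀ / (2 * Real.pi))
    have h2 : D x₀ - 2 * Real.pi * n = 2 * Real.pi * (D x₀ / (2 * Real.pi) - n) := by
      field_simp
    rw [h2, abs_mul, abs_of_pos (by positivity)]
    calc _ ≤ 2 * Real.pi * (1 / 2) := by gcongr
      _ = Real.pi := by ring
  refine ⟨n, fun x hx => ?_⟩
  have hne : ∀ y ∈ S, |D y - 2 * Real.pi * n| ≠ Real.pi / 2 := by
    intro y hy h
    have := hcosE y hy
    rw [← Real.cos_abs, h, Real.cos_pi_div_two] at this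
    exact lt_irrefl _ this
  have hlt₀ : |D x₀ - 2 * Real.pi * n| < Real.pi / 2 := by
    by_contra! h
    have h1 := hcosE x₀ hx₀
    rw [← Real.cos_abs] at h1
    linarith [Real.cos_nonpos_of_pi_div_two_le_of_le h (by linarith)]
  by_contra! hge
  have hcont : ContinuousOn (fun y => |D y - 2 * Real.pi * n|) S :=
    (hD.sub continuousOn_const).abs
  obtain ⟨y, hy, hye⟩ := hS.intermediate_value hx₀ hx hcont ⟨hlt₀.le, hge⟩
  exact hne y hy hye

lemma exists_continuous_log {A : Type*} [TopologicalSpace A] [SimplyConnectedSpace A]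
    [LocallyPathConnectedSpace A] {F : A → ℂ} (hF : Continuous F) (h0 : ∀ a, F a ≠ 0) :
    ∃ L : A → ℂ, Continuous L ∧ ∀ a, Complex.exp (L a) = F a := by
  obtain ⟨a₀⟩ : Nonempty A := inferInstance
  obtain ⟨L, ⟨-, hL⟩, -⟩ := Complex.isCoveringMapOn_exp.existsUnique_continuousMap_lifts
    ⟨F, hF⟩ (a₀ := a₀) (e₀ := Complex.log (F a₀)) (Complex.exp_log (h0 a₀)) h0
  exact ⟨L, L.continuous, fun a => congrFun hL a⟩

lemma re_exp_mul_exp_pos_iff (z : ℂ) (t : ℝ) :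
    0 < (Complex.exp z * Complex.exp (-(t * Complex.I))).re ↔ 0 < Real.cos (z.im - t) := by
  rw [← Complex.exp_add, Complex.exp_re]
  simp [Real.exp_pos, sub_eq_add_neg]

/-- The closed square of half-side `R` centred at the origin. -/
def centeredSquare (R : ℝ) : Set (ℝ × ℝ) := Set.Icc (-R) R ×ˢ Set.Icc (-R) R

lemma exists_zero_of_winding {F : ℝ × ℝ → ℂ} (hF : Continuous F) {R : ℝ} (hR : 0 < R) (c : ℝ)
    {h : ℝ × ℝ → ℝ} (hh : Continuous h)
    (hside : ∀ O ∈ centeredSquare R, (O.2 = R ∨ O.1 = R ∨ O.2 = -R) →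
      0 < (F O * Complex.exp (-((c : ℝ) * Complex.I))).re)
    (hleft : ∀ O ∈ centeredSquare R, O.1 = -R →
      0 < (F O * Complex.exp (-((c + h O : ℝ) * Complex.I))).re)
    (htop : |h (-R, R)| < Real.pi) (hbot : |h (-R, -R) - 2 * Real.pi| < Real.pi) :
    ∃ O ∈ centeredSquare R, F O = 0 := by
  by_contra! hne
  have hpi := Real.pi_pos
  let r : ℝ × ℝ → ℝ × ℝ := fun O => (max (-R) (min R O.1), max (-R) (min R O.2))
  have hr : Continuous r := by fun_prop
  have hrmem : ∀ O, r O ∈ centeredSquare R := fun O =>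
    ⟨⟨le_max_left _ _, max_le (by linarith) (min_le_left _ _)⟩,
      ⟨le_max_left _ _, max_le (by linarith) (min_le_left _ _)⟩⟩
  have hreq : ∀ O ∈ centeredSquare R, r O = O := by
    rintro ⟨x, y⟩ ⟨⟨h1, h2⟩, ⟨h3, h4⟩⟩
    simp only at h1 h2 h3 h4
    simp [r, min_eq_right h2, max_eq_right h1, min_eq_right h4, max_eq_right h3]
  obtain ⟨L, hL, hLF⟩ := exists_continuous_log (hF.comp hr) (fun O => hne _ (hrmem O))
  have hexp : ∀ O ∈ centeredSquare R, F O = Complex.exp (L O) := fun O hO => by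
    rw [hLF, Function.comp, hreq O hO]
  have hLim : Continuous fun O => (L O).im := Complex.continuous_im.comp hL
  have hI : ∀ x, -R ≤ x → x ≤ R → x ∈ Set.Icc (-R) R := fun x h1 h2 => ⟨h1, h2⟩
  have hIR : R ∈ Set.Icc (-R) R := ⟨by linarith, le_rfl⟩
  have hIL : -R ∈ Set.Icc (-R) R := ⟨le_rfl, by linarith⟩
  have window : ∀ {s t : Set ℝ}, Convex ℝ s → Convex ℝ t → s ×ˢ t ⊆ centeredSquare R →
      (∀ O ∈ s ×ˢ t, O.2 = R ∨ O.1 = R ∨ O.2 = -R) →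
      ∃ n : ℤ, ∀ O ∈ s ×ˢ t, |(L O).im - c - 2 * Real.pi * n| < Real.pi / 2 := by
    intro s t hs ht hsub hO
    refine exists_int_abs_sub_lt_of_cos_pos (hs.prod ht).isPreconnected
      (hLim.sub continuous_const).continuousOn fun O hOm => ?_
    rw [← re_exp_mul_exp_pos_iff, ← hexp O (hsub hOm)]
    exact hside O (hsub hOm) (hO O hOm)
  obtain ⟨n₁, hn₁⟩ := window (convex_Icc (-R) R) (convex_singleton R)
    (Set.prod_mono le_rfl (by simpa using hIR)) (fun O hO => Or.inl hO.2)
  obtain ⟨n₂, hn₂⟩ := window (convex_singleton R) (convex_Icc (-R) R)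
    (Set.prod_mono (by simpa using hIR) le_rfl) (fun O hO => Or.inr (Or.inl hO.1))
  obtain ⟨n₃, hn₃⟩ := window (convex_Icc (-R) R) (convex_singleton (-R))
    (Set.prod_mono le_rfl (by simpa using hIL)) (fun O hO => Or.inr (Or.inr hO.2))
  obtain ⟨n₄, hn₄⟩ : ∃ n : ℤ, ∀ O ∈ ({-R} : Set ℝ) ×ˢ Set.Icc (-R) R,
      |(L O).im - (c + h O) - 2 * Real.pi * n| < Real.pi / 2 := by
    have hsub : ({-R} : Set ℝ) ×ˢ Set.Icc (-R) R ⊆ centeredSquare R :=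
      Set.prod_mono (by simpa using hIL) le_rfl
    refine exists_int_abs_sub_lt_of_cos_pos
      ((convex_singleton _).prod (convex_Icc _ _)).isPreconnected
      (hLim.sub (continuous_const.add hh)).continuousOn fun O hOm => ?_
    rw [← re_exp_mul_exp_pos_iff, ← hexp O (hsub hOm)]
    exact hleft O (hsub hOm) hOm.1
  have int_eq : ∀ a b : ℤ, |2 * Real.pi * a - 2 * Real.pi * b| < 2 * Real.pi → a = b := by
    intro a b hab
    rw [← mul_sub, abs_mul, abs_of_pos (by positivity : 0 < 2 * Real.pi)] at hab
    have h1 : |(a : ℝ) - b| < 1 := by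
      by_contra! h2
      nlinarith
    have h2 : |a - b| < 1 := by exact_mod_cast h1
    have := Int.abs_lt_one_iff.1 h2
    omega
  have a1 := abs_lt.1 (hn₁ (R, R) ⟨hIR, rfl⟩)
  have a2 := abs_lt.1 (hn₂ (R, R) ⟨rfl, hIR⟩)
  have b2 := abs_lt.1 (hn₂ (R, -R) ⟨rfl, hIL⟩)
  have b3 := abs_lt.1 (hn₃ (R, -R) ⟨hIR, rfl⟩)
  have c3 := abs_lt.1 (hn₃ (-R, -R) ⟨hIL, rfl⟩)
  have c4 := abs_lt.1 (hn₄ (-R, -R) ⟨rfl, hIL⟩)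
  have d1 := abs_lt.1 (hn₁ (-R, R) ⟨hIL, rfl⟩)
  have d4 := abs_lt.1 (hn₄ (-R, R) ⟨rfl, hIR⟩)
  rw [abs_lt] at htop hbot
  have e1 : n₁ = n₂ := int_eq _ _ (abs_lt.2 ⟨by linarith, by linarith⟩)
  have e2 : n₂ = n₃ := int_eq _ _ (abs_lt.2 ⟨by linarith, by linarith⟩)
  have e3 : n₁ = n₄ := int_eq _ _ (abs_lt.2 ⟨by linarith, by linarith⟩)
  have e4 : n₃ = n₄ + 1 := int_eq _ _
    (abs_lt.2 ⟨by push_cast; linarith, by push_cast; linarith⟩)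
  omega

/-- The vector recording, on the `q`-th roots of unity, how much each `p`-wedge of the angle
sequence `θ` fails to be convex. -/
def excessVector (q p : ℕ) (θ : ℤ → ℝ) : ℂ :=
  ∑ k ∈ Finset.range q, ((max (θ (k + p) - θ k - Real.pi) 0 : ℝ) : ℂ) *
    Complex.exp ((2 * Real.pi * k / q : ℝ) * Complex.I)

lemma add_int_mul_of_add {q : ℕ} {θ : ℤ → ℝ} (hθ : ∀ j : ℤ, θ (j + q) = θ j + 2 * Real.pi)
    (j n : ℤ) : θ (j + n * q) = θ j + 2 * Real.pi * n := by
  induction n using Int.induction_on with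
  | zero => simp
  | succ n ih =>
    have := hθ (j + n * q)
    rw [show j + ((n : ℤ) + 1) * q = j + n * q + q by ring, this, ih]
    push_cast; ring
  | pred n ih =>
    have := hθ (j + (-(n : ℤ) - 1) * q)
    rw [show j + (-(n : ℤ) - 1) * q + q = j + -(n : ℤ) * q by ring, ih] at this
    push_cast at this ⊢; linarith

lemma re_excessVector_mul_exp_pos {q p : ℕ} (hq : 0 < q) {θ : ℤ → ℝ}
    (hθ : ∀ j : ℤ, θ (j + q) = θ j + 2 * Real.pi)
    (hbad : ∃ k : ℤ, Real.pi < θ (k + p) - θ k) (c : ℝ)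
    (hc : ∀ k : ℤ, Real.pi < θ (k + p) - θ k → ∃ n : ℤ, |((k + n * q : ℤ) : ℝ) - c| < q / 4) :
    0 < (excessVector q p θ *
      Complex.exp (-((2 * Real.pi * c / q : ℝ) * Complex.I))).re := by
  have hpi := Real.pi_pos
  have hq' : (0 : ℝ) < q := by exact_mod_cast hq
  have key : (excessVector q p θ * Complex.exp (-((2 * Real.pi * c / q : ℝ) * Complex.I))).re =
      ∑ k ∈ Finset.range q, max (θ (k + p) - θ k - Real.pi) 0 *
        Real.cos (2 * Real.pi * (k - c) / q) := by
    rw [excessVector, Finset.sum_mul, Complex.re_sum]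
    refine Finset.sum_congr rfl fun k _ => ?_
    rw [mul_assoc, ← Complex.exp_add, Complex.re_ofReal_mul]
    congr 1
    rw [show ((2 * Real.pi * k / q : ℝ) : ℂ) * Complex.I +
      -((2 * Real.pi * c / q : ℝ) * Complex.I) = ((2 * Real.pi * (k - c) / q : ℝ) : ℂ) * Complex.I
      by push_cast; ring, Complex.exp_ofReal_mul_I_re]
  have hcos : ∀ k : ℤ, Real.pi < θ (k + p) - θ k → 0 < Real.cos (2 * Real.pi * (k - c) / q) := by
    intro k hk
    obtain ⟨n, hn⟩ := hc k hk
    rw [← Real.cos_add_int_mul_two_pi _ n]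
    have e : 2 * Real.pi * (k - c) / q + n * (2 * Real.pi) =
        2 * Real.pi / q * (((k + n * q : ℤ) : ℝ) - c) := by
      push_cast; field_simp; ring
    rw [e]
    refine Real.cos_pos_of_mem_Ioo (abs_lt.1 ?_)
    rw [abs_mul, abs_of_pos (by positivity)]
    calc _ < 2 * Real.pi / q * (q / 4) := by gcongr
      _ = Real.pi / 2 := by field_simp; norm_num
  rw [key]
  refine Finset.sum_pos' (fun k _ => ?_) ?_
  · by_cases hk : Real.pi < θ (k + p) - θ k
    · exact mul_nonneg (le_max_right _ _) (hcos k hk).le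
    · rw [max_eq_right (by linarith), zero_mul]
  · obtain ⟨k, hk⟩ := hbad
    have h1 : 0 ≤ k % q := Int.emod_nonneg _ (by omega)
    have h2 : k % q < q := Int.emod_lt_of_pos _ (by omega)
    have h3 : ((k % q).toNat : ℤ) = k % q := Int.toNat_of_nonneg h1
    have h4 : Real.pi < θ (((k % q).toNat : ℤ) + p) - θ ((k % q).toNat : ℤ) := by
      have e := Int.emod_add_mul_ediv k q
      have e1 := add_int_mul_of_add hθ (k % q) (k / q)
      have e2 := add_int_mul_of_add hθ (k % q + p) (k / q)
      rw [show k % q + p + k / q * q = k + p by linear_combination e] at e2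
      rw [show k % q + k / q * q = k by linear_combination e] at e1
      rw [h3]; linarith
    refine ⟨(k % q).toNat, by simp; omega, mul_pos ?_ (by exact_mod_cast hcos _ h4)⟩
    exact lt_max_of_lt_left (by linarith)

lemma not_lt_of_le_of_le {q p : ℕ} {θ : ℤ → ℝ} (hθ : ∀ j : ℤ, θ (j + q) = θ j + 2 * Real.pi)
    (hmono : Monotone θ) {j k : ℤ} (hk : Real.pi < θ (k + p) - θ k) (h1 : k + p ≤ j)
    (h2 : j + p ≤ k + q) : ¬ Real.pi < θ (j + p) - θ j := by
  have e1 := hmono h1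
  have e2 := hmono h2
  rw [hθ] at e2
  linarith

lemma excessVector_ne_zero {q p : ℕ} (hp : 1 ≤ p) (hq : q + 1 = 3 * p) {θ : ℤ → ℝ}
    (hθ : ∀ j : ℤ, θ (j + q) = θ j + 2 * Real.pi) (hmono : Monotone θ)
    (hbad : ∃ k : ℤ, Real.pi < θ (k + p) - θ k) : excessVector q p θ ≠ 0 := by
  classical
  obtain ⟨k₀, hk₀⟩ := hbad
  let S : Finset ℤ := (Finset.Icc (k₀ - p + 1) (k₀ + p - 1)).filter
    fun k => Real.pi < θ (k + p) - θ k
  have hS : S.Nonempty :=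
    ⟨k₀, by simp only [S, Finset.mem_filter, Finset.mem_Icc]; exact ⟨by omega, hk₀⟩⟩
  have hmin := S.min'_mem hS
  have hmax := S.max'_mem hS
  set a := S.min' hS
  set b := S.max' hS
  have hS' : ∀ k, k ∈ S ↔ (k₀ - p + 1 ≤ k ∧ k ≤ k₀ + p - 1) ∧ Real.pi < θ (k + p) - θ k :=
    fun k => by simp only [S, Finset.mem_filter, Finset.mem_Icc]
  rw [hS'] at hmin hmax
  have hab : b - a ≤ p - 1 := by
    by_contra! h
    exact not_lt_of_le_of_le hθ hmono hmin.2 (by omega : a + p ≤ b) (by omega) hmax.2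
  intro h0
  have := re_excessVector_mul_exp_pos (p := p) (by omega) hθ ⟨k₀, hk₀⟩ (((a + b : ℤ) : ℝ) / 2) ?_
  · simp [h0] at this
  intro k hk
  have e := Int.emod_add_mul_ediv (k - (k₀ - p + 1)) q
  have l1 : 0 ≤ (k - (k₀ - p + 1)) % q := Int.emod_nonneg _ (by omega)
  have l2 : (k - (k₀ - p + 1)) % q < q := Int.emod_lt_of_pos _ (by omega)
  set n := (k - (k₀ - p + 1)) / (q : ℤ)
  have ek : k + (-n) * q = (k - (k₀ - p + 1)) % q + (k₀ - p + 1) := by linear_combination -e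
  set k' := k + (-n) * q with hk'
  have hbad' : Real.pi < θ (k' + p) - θ k' := by
    have e1 := add_int_mul_of_add hθ k (-n)
    have e2 := add_int_mul_of_add hθ (k + p) (-n)
    rw [show k + p + -n * q = k' + p by rw [hk']; ring] at e2
    linarith
  have hle : k' ≤ k₀ + p - 1 := by
    by_contra! h
    exact not_lt_of_le_of_le hθ hmono hk₀ (by omega : k₀ + p ≤ k') (by omega) hbad'
  have hmem : k' ∈ S := (hS' k').2 ⟨⟨by omega, hle⟩, hbad'⟩
  have m1 := S.min'_le k' hmem
  have m2 := S.le_max' k' hmem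
  refine ⟨-n, ?_⟩
  rw [← hk']
  have m1' : (a : ℝ) ≤ k' := by exact_mod_cast m1
  have m2' : (k' : ℝ) ≤ b := by exact_mod_cast m2
  have hab' : (b : ℝ) - a ≤ p - 1 := by exact_mod_cast hab
  have hq' : (q : ℝ) + 1 = 3 * p := by exact_mod_cast hq
  have hp' : (1 : ℝ) ≤ p := by exact_mod_cast hp
  rw [abs_lt]; push_cast
  constructor <;> linarith

lemma exists_convex_of_boundary {q p : ℕ} (hp : 2 ≤ p) (hq : q + 1 = 3 * p) {R : ℝ} (hR : 0 < R)
    {θ : ℝ × ℝ → ℤ → ℝ} (hcont : ∀ j, Continuous fun O => θ O j)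
    (hθ : ∀ O, ∀ j : ℤ, θ O (j + q) = θ O j + 2 * Real.pi) (hmono : ∀ O, Monotone (θ O))
    {g : ℝ × ℝ → ℝ} (hg : Continuous g) (hg0 : ∀ O, 0 ≤ g O) (hg1 : ∀ O, g O ≤ 1)
    (hside : ∀ O ∈ centeredSquare R, (O.2 = R ∨ O.1 = R ∨ O.2 = -R) →
      ∀ i j : ℤ, 1 ≤ i → i ≤ j → j + 1 ≤ q → θ O j - θ O i ≤ Real.pi)
    (hleft : ∀ O ∈ centeredSquare R, O.1 = -R → ∀ j : ℤ, 0 ≤ j → j ≤ q →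
      0 ≤ θ O j ∧ θ O j ≤ 2 * Real.pi ∧
      ((j : ℝ) < q * g O - 1 / 8 → θ O j ≤ Real.pi / 2) ∧
      (q * g O + 1 / 8 < (j : ℝ) → 3 * Real.pi / 2 ≤ θ O j))
    (htop : g (-R, R) < 1 / 2) (hbot : 1 / 2 < g (-R, -R)) :
    ∃ O ∈ centeredSquare R, ∀ k : ℤ, θ O (k + p) - θ O k ≤ Real.pi := by
  by_contra! hbad
  have hpi := Real.pi_pos
  have hq0 : 0 < q := by omega
  have hq' : (q : ℝ) + 1 = 3 * p := by exact_mod_cast hq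
  have hp' : (2 : ℝ) ≤ p := by exact_mod_cast hp
  have hqpos : (0 : ℝ) < q := by exact_mod_cast hq0
  have hF : Continuous fun O => excessVector q p (θ O) := by
    unfold excessVector
    refine continuous_finsetSum _ fun k _ => Continuous.mul ?_ continuous_const
    have h1 := hcont (k + p)
    have h2 := hcont k
    fun_prop
  have shift : ∀ O, ∀ k n : ℤ, Real.pi < θ O (k + p) - θ O k →
      Real.pi < θ O (k + n * q + p) - θ O (k + n * q) := by
    intro O k n hk
    have e1 := add_int_mul_of_add (hθ O) k n
    have e2 := add_int_mul_of_add (hθ O) (k + p) n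
    rw [show k + p + n * q = k + n * q + p by ring] at e2
    linarith
  suffices ∃ O ∈ centeredSquare R, excessVector q p (θ O) = 0 by
    obtain ⟨O, hO, hO0⟩ := this
    exact excessVector_ne_zero (by omega) hq (hθ O) (hmono O) (hbad O hO) hO0
  refine exists_zero_of_winding hF hR (2 * Real.pi * (-(p : ℝ) / 2) / q)
    (h := fun O => 2 * Real.pi * g O) (by fun_prop) ?_ ?_ ?_ ?_
  · intro O hO hs
    refine re_excessVector_mul_exp_pos hq0 (hθ O) (hbad O hO) _ fun k hk => ?_
    have e := Int.emod_add_mul_ediv k q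
    have l1 : 0 ≤ k % q := Int.emod_nonneg _ (by omega)
    have l2 : k % q < q := Int.emod_lt_of_pos _ (by omega)
    have hk0 := shift O k (-(k / q)) hk
    rw [show k + -(k / q) * q = k % q by linear_combination -e] at hk0
    by_cases h0 : k % q = 0
    · refine ⟨-(k / q), ?_⟩
      rw [show k + -(k / q) * q = k % q by linear_combination -e, h0, abs_lt]
      push_cast; constructor <;> linarith
    · have hge : (q : ℤ) ≤ k % q + p := by
        by_contra! h
        have := hside O hO hs (k % q) (k % q + p) (by omega) (by omega) (by omega)
        linarith
      refine ⟨-(k / q) - 1, ?_⟩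
      rw [show k + (-(k / q) - 1) * q = k % q - q by linear_combination -e, abs_lt]
      have hge' : (q : ℝ) ≤ (k % q : ℤ) + p := by exact_mod_cast hge
      have l2' : ((k % q : ℤ) : ℝ) < q := by exact_mod_cast l2
      push_cast at hge' l2' ⊢; constructor <;> linarith
  · intro O hO hs
    have hc : 2 * Real.pi * (-(p : ℝ) / 2) / q + 2 * Real.pi * g O =
        2 * Real.pi * (q * g O - p / 2) / q := by field_simp; ring
    simp only [hc]
    refine re_excessVector_mul_exp_pos hq0 (hθ O) (hbad O hO) _ fun k hk => ?_
    have e := Int.emod_add_mul_ediv k q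
    have l1 : 0 ≤ k % q := Int.emod_nonneg _ (by omega)
    have l2 : k % q < q := Int.emod_lt_of_pos _ (by omega)
    have hk0 := shift O k (-(k / q)) hk
    have er : k + -(k / q) * q = k % q := by linear_combination -e
    have er' : k + (-(k / q) - 1) * q = k % q - q := by linear_combination -e
    rw [er] at hk0
    have hg0' := mul_nonneg hqpos.le (hg0 O)
    have l1' : (0 : ℝ) ≤ (k % q : ℤ) := by exact_mod_cast l1
    have l2' : ((k % q : ℤ) : ℝ) < q := by exact_mod_cast l2
    generalize k % q = m at *
    have hl := hleft O hO hs
    obtain ⟨t0, t1, t2, t3⟩ := hl m l1 l2.le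
    by_cases hmq : m + p ≤ q
    · obtain ⟨s0, s1, s2, s3⟩ := hl (m + p) (by omega) hmq
      have c1 : q * g O - 1 / 8 ≤ ((m + p : ℤ) : ℝ) := by
        by_contra! h
        linarith [s2 h]
      have c2 : (m : ℝ) ≤ q * g O + 1 / 8 := by
        by_contra! h
        linarith [t3 h]
      refine ⟨-(k / q), ?_⟩
      rw [er, abs_lt]
      push_cast at c1 ⊢; constructor <;> linarith
    · obtain ⟨s0, s1, s2, s3⟩ := hl (m + p - q) (by omega) (by omega)
      have ew := hθ O (m + p - q)
      rw [sub_add_cancel] at ew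
      by_cases c2 : (m : ℝ) ≤ q * g O + 1 / 8
      · refine ⟨-(k / q), ?_⟩
        have c1 : (q : ℝ) < m + p := by exact_mod_cast not_le.1 hmq
        have := mul_le_mul_of_nonneg_left (hg1 O) hqpos.le
        rw [er, abs_lt]
        constructor <;> linarith
      · have c3 := t3 (not_le.1 c2)
        have c1 : q * g O - 1 / 8 ≤ ((m + p - q : ℤ) : ℝ) := by
          by_contra! h
          linarith [s2 h]
        refine ⟨-(k / q) - 1, ?_⟩
        rw [er', abs_lt]
        push_cast at c1 ⊢; constructor <;> linarith
  · have := hg0 (-R, R)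
    rw [abs_lt]; constructor <;> nlinarith
  · have := hg1 (-R, -R)
    rw [abs_lt]; constructor <;> nlinarith

lemma continuous_of_strictMono_eq {X : Type*} [TopologicalSpace X] {G : X → ℝ → ℝ}
    (hG : Continuous fun z : X × ℝ => G z.1 z.2) (hmono : ∀ x, StrictMono (G x))
    {φ : X → ℝ} {c : ℝ}
    (hφ : ∀ x, G x (φ x) = c) : Continuous φ := by
  rw [continuous_iff_continuousAt]
  intro x
  have hGt : ∀ t, Continuous fun y => G y t := fun t => hG.comp (by fun_prop : Continuous fun y => (y, t))
  refine tendsto_order.2 ⟨fun a ha => ?_, fun a ha => ?_⟩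
  · have h1 : G x a < c := hφ x ▸ hmono x ha
    filter_upwards [(hGt a).continuousAt.eventually_lt continuousAt_const h1] with y hy
    rwa [← hφ y, (hmono y).lt_iff_lt] at hy
  · have h1 : c < G x a := hφ x ▸ hmono x ha
    filter_upwards [continuousAt_const.eventually_lt (hGt a).continuousAt h1] with y hy
    rwa [← hφ y, (hmono y).lt_iff_lt] at hy

lemma exists_continuous_quantiles {X : Type*} [TopologicalSpace X] {G : X → ℝ → ℝ}
    (hG : Continuous fun z : X × ℝ => G z.1 z.2) (hmono : ∀ x, StrictMono (G x))
    (hG0 : ∀ x, G x 0 = 0) (hG1 : ∀ x, G x (2 * Real.pi) = 1) {q : ℕ} (hq : 0 < q) :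
    ∃ θ : X → ℤ → ℝ, (∀ j, Continuous fun x => θ x j) ∧
      (∀ x, ∀ j : ℤ, θ x (j + q) = θ x j + 2 * Real.pi) ∧ (∀ x, Monotone (θ x)) ∧
      (∀ x, θ x 0 = 0) ∧ ∀ x, ∀ j : ℤ, 0 ≤ j → j ≤ q → G x (θ x j) = j / q := by
  have hq' : (0 : ℝ) < q := by exact_mod_cast hq
  have hGx : ∀ x, Continuous (G x) := fun x => hG.comp (by fun_prop : Continuous fun t => (x, t))
  have hex : ∀ x, ∀ j : ℤ, ∃ t, G x t = ((j % q : ℤ) : ℝ) / q := by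
    intro x j
    have l1 : (0 : ℝ) ≤ (j % q : ℤ) := by exact_mod_cast Int.emod_nonneg _ (by omega)
    have l2 : ((j % q : ℤ) : ℝ) ≤ q := by exact_mod_cast (Int.emod_lt_of_pos _ (by omega)).le
    have hmem : ((j % q : ℤ) : ℝ) / q ∈ Set.Icc (G x 0) (G x (2 * Real.pi)) := by
      rw [hG0, hG1]
      exact ⟨by positivity, (div_le_one hq').2 l2⟩
    obtain ⟨t, -, ht⟩ := intermediate_value_Icc Real.two_pi_pos.le (hGx x).continuousOn hmem
    exact ⟨t, ht⟩
  choose φ hφ using hex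
  have hφ0 : ∀ x, φ x 0 = 0 := fun x => (hmono x).injective (by rw [hφ, hG0]; simp)
  have hmod : ∀ x, ∀ i j : ℤ, i % q = j % q → φ x i = φ x j := fun x i j h =>
    (hmono x).injective (by rw [hφ, hφ, h])
  have hquasi : ∀ x, ∀ j : ℤ, φ x (j + q) + 2 * Real.pi * ((j + q) / (q : ℤ) : ℤ) =
      φ x j + 2 * Real.pi * (j / (q : ℤ) : ℤ) + 2 * Real.pi := by
    intro x j
    rw [hmod x (j + q) j (by simp), Int.add_ediv_of_dvd_right (dvd_refl _),
      Int.ediv_self (by omega)]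
    push_cast; ring
  have hlevel : ∀ x, ∀ j : ℤ, 0 ≤ j → j ≤ q →
      G x (φ x j + 2 * Real.pi * (j / (q : ℤ) : ℤ)) = j / q := by
    intro x j h0 h1
    rcases h1.lt_or_eq with h | rfl
    · rw [Int.ediv_eq_zero_of_lt h0 h, Int.cast_zero, mul_zero, add_zero, hφ,
        Int.emod_eq_of_lt h0 h]
    · have := hquasi x 0
      rw [zero_add, hφ0, Int.zero_ediv] at this
      rw [this]
      simp [hG1, hq.ne']
  refine ⟨fun x j => φ x j + 2 * Real.pi * (j / (q : ℤ) : ℤ), fun j => ?_, hquasi, fun x => ?_,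
    fun x => by simp [hφ0], hlevel⟩
  · exact (continuous_of_strictMono_eq hG hmono fun x => hφ x j).add continuous_const
  · refine monotone_int_of_le_succ fun j => ?_
    have key := add_int_mul_of_add (q := q)
      (θ := fun j => φ x j + 2 * Real.pi * (j / (q : ℤ) : ℤ)) (hquasi x)
    have e := Int.emod_add_mul_ediv j q
    have l1 : 0 ≤ j % q := Int.emod_nonneg _ (by omega)
    have l2 : j % q < q := Int.emod_lt_of_pos _ (by omega)
    have k1 := key (j % q) (j / q)
    have k2 := key (j % q + 1) (j / q)
    rw [show j % q + j / q * q = j by linear_combination e] at k1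
    rw [show j % q + 1 + j / q * q = j + 1 by linear_combination e] at k2
    change φ x j + 2 * Real.pi * (j / (q : ℤ) : ℤ) ≤
      φ x (j + 1) + 2 * Real.pi * ((j + 1) / (q : ℤ) : ℤ)
    rw [k1, k2]
    refine add_le_add_left ((hmono x).le_iff_le.1 ?_) _
    rw [hlevel x _ l1 l2.le, hlevel x _ (by omega) (by omega)]
    push_cast; gcongr; linarith

lemma exists_convex_of_angular_distribution {q p : ℕ} (hp : 2 ≤ p) (hq : q + 1 = 3 * p) {R : ℝ}
    (hR : 0 < R) {G : ℝ × ℝ → ℝ → ℝ} (hG : Continuous fun z : (ℝ × ℝ) × ℝ => G z.1 z.2)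
    (hmono : ∀ O, StrictMono (G O)) (hG0 : ∀ O, G O 0 = 0) (hG1 : ∀ O, G O (2 * Real.pi) = 1)
    (htop : ∀ O : ℝ × ℝ, O.2 = R → q * G O Real.pi ≤ 1 / 8)
    (hbot : ∀ O : ℝ × ℝ, O.2 = -R → q * (1 - G O Real.pi) ≤ 1 / 8)
    (hright : ∀ O : ℝ × ℝ, O.1 = R →
      q * G O (Real.pi / 2) ≤ 1 / 8 ∧ q * (1 - G O (3 * Real.pi / 2)) ≤ 1 / 8)
    (hleft : ∀ O : ℝ × ℝ, O.1 = -R →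
      q * (G O (3 * Real.pi / 2) - G O (Real.pi / 2)) ≤ 1 / 8) :
    ∃ O ∈ centeredSquare R, ∃ θ : ℤ → ℝ, (∀ j : ℤ, θ (j + q) = θ j + 2 * Real.pi) ∧
      Monotone θ ∧ θ 0 = 0 ∧ (∀ j : ℤ, 0 ≤ j → j ≤ q → G O (θ j) = j / q) ∧
      ∀ k : ℤ, θ (k + p) - θ k ≤ Real.pi := by
  have hpi := Real.pi_pos
  have hq0 : 0 < q := by omega
  have hq2 : (2 : ℝ) ≤ q := by exact_mod_cast (by omega : 2 ≤ q)
  have hqpos : (0 : ℝ) < q := by linarith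
  obtain ⟨θ, hc, hθ, hm, h0, hl⟩ := exists_continuous_quantiles hG hmono hG0 hG1 hq0
  have hl' : ∀ x, ∀ j : ℤ, 0 ≤ j → j ≤ q → q * G x (θ x j) = j := fun x j h1 h2 => by
    rw [hl x j h1 h2]; field_simp
  have hrange : ∀ O, ∀ j : ℤ, 0 ≤ j → j ≤ q → 0 ≤ θ O j ∧ θ O j ≤ 2 * Real.pi := by
    intro O j h1 h2
    have a := hm O h1
    have b := hm O h2
    have c := hθ O 0
    rw [zero_add, h0, zero_add] at c
    exact ⟨h0 O ▸ a, c ▸ b⟩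
  have lower : ∀ O, ∀ j : ℤ, 0 ≤ j → j ≤ q → ∀ t, q * G O t ≤ j → t ≤ θ O j := by
    intro O j h1 h2 t ht
    rw [← hl' O j h1 h2] at ht
    exact (hmono O).le_iff_le.1 (le_of_mul_le_mul_left ht hqpos)
  have upper : ∀ O, ∀ j : ℤ, 0 ≤ j → j ≤ q → ∀ t, j ≤ q * G O t → θ O j ≤ t := by
    intro O j h1 h2 t ht
    rw [← hl' O j h1 h2] at ht
    exact (hmono O).le_iff_le.1 (le_of_mul_le_mul_left ht hqpos)
  have g0 : ∀ O, 0 ≤ G O Real.pi := fun O => hG0 O ▸ ((hmono O) hpi).le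
  have g1 : ∀ O, G O Real.pi ≤ 1 := fun O => hG1 O ▸ ((hmono O) (by linarith)).le
  suffices ∃ O ∈ centeredSquare R, ∀ k : ℤ, θ O (k + p) - θ O k ≤ Real.pi by
    obtain ⟨O, hO, h⟩ := this
    exact ⟨O, hO, θ O, hθ O, hm O, h0 O, hl O, h⟩
  refine exists_convex_of_boundary hp hq hR hc hθ hm (g := fun O => G O Real.pi)
    (hG.comp (by fun_prop : Continuous fun O : ℝ × ℝ => (O, Real.pi))) g0 g1 ?_ ?_ ?_ ?_
  · intro O hO hs i j hi hij hj
    have hi' : (1 : ℝ) ≤ i := by exact_mod_cast hi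
    have hj' : (j : ℝ) + 1 ≤ q := by exact_mod_cast hj
    rcases hs with hs | hs | hs
    · have := lower O i (by omega) (by omega) Real.pi (by linarith [htop O hs])
      linarith [(hrange O j (by omega) (by omega)).2]
    · have a1 := lower O i (by omega) (by omega) (Real.pi / 2) (by linarith [(hright O hs).1])
      have a2 := upper O j (by omega) (by omega) (3 * Real.pi / 2) (by linarith [(hright O hs).2])
      linarith
    · have := upper O j (by omega) (by omega) Real.pi (by linarith [hbot O hs])
      linarith [(hrange O i (by omega) (by omega)).1]
  · intro O hO hs j h1 h2
    have m1 := mul_le_mul_of_nonneg_left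
      ((hmono O) (by linarith : Real.pi / 2 < Real.pi)).le hqpos.le
    have m2 := mul_le_mul_of_nonneg_left
      ((hmono O) (by linarith : Real.pi < 3 * Real.pi / 2)).le hqpos.le
    have hl1 := hleft O hs
    refine ⟨(hrange O j h1 h2).1, (hrange O j h1 h2).2, fun h => ?_, fun h => ?_⟩
    · exact upper O j h1 h2 _ (by linarith)
    · exact lower O j h1 h2 _ (by linarith)
  · have := htop (-R, R) rfl
    by_contra! h
    nlinarith
  · have := hbot (-R, -R) rfl
    by_contra! h
    nlinarith

/-- The polar angle of a plane vector, normalised to lie in `(0, 2π]`. -/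
def polarAngle (v : ℝ × ℝ) : ℝ := Real.pi + Complex.arg ⟨-v.1, -v.2⟩

lemma polarAngle_pos (v : ℝ × ℝ) : 0 < polarAngle v := by
  have := Complex.neg_pi_lt_arg ⟨-v.1, -v.2⟩
  unfold polarAngle; linarith

lemma polarAngle_le (v : ℝ × ℝ) : polarAngle v ≤ 2 * Real.pi := by
  have := Complex.arg_le_pi ⟨-v.1, -v.2⟩
  unfold polarAngle; linarith

lemma continuous_complex_mk_neg : Continuous fun v : ℝ × ℝ => (⟨-v.1, -v.2⟩ : ℂ) := by
  have : (fun v : ℝ × ℝ => (⟨-v.1, -v.2⟩ : ℂ)) =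
      fun v => ((-v.1 : ℝ) : ℂ) + ((-v.2 : ℝ) : ℂ) * Complex.I := by
    ext v; exact Complex.mk_eq_add_mul_I _ _
  rw [this]; fun_prop

lemma measurable_polarAngle : Measurable polarAngle := by
  exact measurable_const.add (Complex.measurable_arg.comp continuous_complex_mk_neg.measurable)

lemma continuousAt_polarAngle {v : ℝ × ℝ} (hv : v.2 ≠ 0) : ContinuousAt polarAngle v := by
  refine continuousAt_const.add (ContinuousAt.comp (f := fun v : ℝ × ℝ => (⟨-v.1, -v.2⟩ : ℂ))
    (Complex.continuousAt_arg ?_) continuous_complex_mk_neg.continuousAt)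
  exact Or.inr (neg_ne_zero.2 hv)

lemma polarAngle_smul {r θ : ℝ} (hr : 0 < r) (h0 : 0 < θ) (h1 : θ ≤ 2 * Real.pi) :
    polarAngle (r • (Real.cos θ, Real.sin θ)) = θ := by
  have h := Complex.arg_mul_cos_add_sin_mul_I hr (θ := θ - Real.pi) ⟨by linarith, by linarith⟩
  have e : (⟨-(r • (Real.cos θ, Real.sin θ)).1, -(r • (Real.cos θ, Real.sin θ)).2⟩ : ℂ) =
      r * (Complex.cos ((θ - Real.pi : ℝ) : ℂ) +
        Complex.sin ((θ - Real.pi : ℝ) : ℂ) * Complex.I) := by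
    rw [← Complex.ofReal_cos, ← Complex.ofReal_sin, Real.cos_sub_pi, Real.sin_sub_pi]
    apply Complex.ext <;> simp [-Complex.ofReal_cos, -Complex.ofReal_sin]
  rw [polarAngle, e, h]; ring

lemma exists_eq_smul_polarAngle {v : ℝ × ℝ} (hv : v ≠ 0) :
    ∃ r : ℝ, 0 < r ∧ v = r • (Real.cos (polarAngle v), Real.sin (polarAngle v)) := by
  set z : ℂ := ⟨-v.1, -v.2⟩ with hz
  have hz0 : z ≠ 0 := by
    intro h
    apply hv
    have h1 := congrArg Complex.re h
    have h2 := congrArg Complex.im h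
    simp only [hz, Complex.zero_re, Complex.zero_im, neg_eq_zero] at h1 h2
    exact Prod.ext h1 h2
  refine ⟨‖z‖, norm_pos_iff.2 hz0, ?_⟩
  have h1 := Complex.norm_mul_cos_arg z
  have h2 := Complex.norm_mul_sin_arg z
  rw [polarAngle, add_comm Real.pi, Real.cos_add_pi, Real.sin_add_pi]
  apply Prod.ext
  · simp only [Prod.smul_mk, smul_eq_mul, mul_neg, ← hz, h1]
    simp [hz]
  · simp only [Prod.smul_mk, smul_eq_mul, mul_neg, ← hz, h2]
    simp [hz]

/-- The line through `O` with direction angle `α`. -/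
def directedLine (O : ℝ × ℝ) (α : ℝ) : Set (ℝ × ℝ) :=
  {x | ∃ t : ℝ, x = O + t • (Real.cos α, Real.sin α)}

lemma isAffineLine_directedLine (O : ℝ × ℝ) (α : ℝ) : IsAffineLine (directedLine O α) := by
  refine ⟨O, (Real.cos α, Real.sin α), fun h => ?_, rfl⟩
  have h1 := congrArg Prod.fst h
  have h2 := congrArg Prod.snd h
  simp only [Prod.fst_zero, Prod.snd_zero] at h1 h2
  have := Real.sin_sq_add_cos_sq α
  rw [h1, h2] at this
  norm_num at this

lemma IsMass.ae_notMem_directedLine {μ : Measure (ℝ × ℝ)} (hμ : IsMass μ) (O : ℝ × ℝ) (α : ℝ) :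
    ∀ᵐ x ∂μ, x ∉ directedLine O α :=
  measure_eq_zero_iff_ae_notMem.1 (hμ.2 _ (isAffineLine_directedLine O α))

lemma self_mem_directedLine (O : ℝ × ℝ) (α : ℝ) : O ∈ directedLine O α := ⟨0, by simp⟩

lemma mem_directedLine_polarAngle {O x : ℝ × ℝ} : x ∈ directedLine O (polarAngle (x - O)) := by
  by_cases h : x - O = 0
  · rw [sub_eq_zero.1 h]; exact self_mem_directedLine _ _
  · obtain ⟨r, -, hr⟩ := exists_eq_smul_polarAngle h
    exact ⟨r, by rw [← hr]; abel⟩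

/-- The mass of the wedge with apex `O` spanned by the angles in `(0, θ]`. -/
def angularMass (μ : Measure (ℝ × ℝ)) (O : ℝ × ℝ) (θ : ℝ) : ℝ :=
  μ.real {x | polarAngle (x - O) ≤ θ}

lemma measurable_polarAngle_sub (O : ℝ × ℝ) : Measurable fun x => polarAngle (x - O) :=
  measurable_polarAngle.comp (measurable_id.sub_const O)

lemma measurableSet_polarAngle_le (O : ℝ × ℝ) (θ : ℝ) :
    MeasurableSet {x | polarAngle (x - O) ≤ θ} :=
  measurableSet_le (measurable_polarAngle_sub O) measurable_const

lemma angularMass_mono (μ : Measure (ℝ × ℝ)) [IsProbabilityMeasure μ] (O : ℝ × ℝ) :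
    Monotone (angularMass μ O) := fun _ _ h => measureReal_mono fun _ hx => le_trans hx h

lemma angularMass_zero (μ : Measure (ℝ × ℝ)) (O : ℝ × ℝ) : angularMass μ O 0 = 0 := by
  have : {x | polarAngle (x - O) ≤ 0} = ∅ :=
    Set.eq_empty_iff_forall_notMem.2 fun x hx => not_le.2 (polarAngle_pos _) hx
  rw [angularMass, this, measureReal_empty]

lemma angularMass_two_pi (μ : Measure (ℝ × ℝ)) [IsProbabilityMeasure μ] (O : ℝ × ℝ) :
    angularMass μ O (2 * Real.pi) = 1 := by
  have : {x | polarAngle (x - O) ≤ 2 * Real.pi} = Set.univ :=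
    Set.eq_univ_iff_forall.2 fun x => polarAngle_le _
  rw [angularMass, this, probReal_univ]

lemma angularMass_sub (μ : Measure (ℝ × ℝ)) [IsProbabilityMeasure μ] (O : ℝ × ℝ) {α β : ℝ}
    (h : α ≤ β) : angularMass μ O β - angularMass μ O α =
      μ.real {x | α < polarAngle (x - O) ∧ polarAngle (x - O) ≤ β} := by
  have hsub : {x | polarAngle (x - O) ≤ α} ⊆ {x | polarAngle (x - O) ≤ β} :=
    fun x hx => le_trans hx h
  rw [angularMass, angularMass, ← measureReal_sdiff hsub (measurableSet_polarAngle_le O α)]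
  congr 1
  ext x
  simp [and_comm]

lemma one_sub_angularMass (μ : Measure (ℝ × ℝ)) [IsProbabilityMeasure μ] (O : ℝ × ℝ) (α : ℝ) :
    1 - angularMass μ O α = μ.real {x | α < polarAngle (x - O)} := by
  rw [angularMass, ← probReal_compl_eq_one_sub (measurableSet_polarAngle_le O α)]
  congr 1
  ext x
  simp

lemma IsMass.continuous_angularMass {μ : Measure (ℝ × ℝ)} (hμ : IsMass μ) :
    Continuous fun z : (ℝ × ℝ) × ℝ => angularMass μ z.1 z.2 := by
  have := hμ.1
  have e : (fun z : (ℝ × ℝ) × ℝ => angularMass μ z.1 z.2) = fun z : (ℝ × ℝ) × ℝ =>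
      ∫ x, Set.indicator {x | polarAngle (x - z.1) ≤ z.2} (fun _ => (1 : ℝ)) x ∂μ := by
    ext z
    rw [integral_indicator_const _ (measurableSet_polarAngle_le _ _)]
    simp [angularMass]
  rw [e, continuous_iff_continuousAt]
  rintro ⟨O, θ⟩
  refine continuousAt_of_dominated (bound := fun _ => 1)
    (Filter.Eventually.of_forall fun z => (measurable_const.indicator
      (measurableSet_polarAngle_le _ _)).aestronglyMeasurable)
    (Filter.Eventually.of_forall fun z => Filter.Eventually.of_forall fun x => ?_)
    (integrable_const _) ?_
  · refine (norm_indicator_le_norm_self _ _).trans (by simp)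
  · filter_upwards [hμ.ae_notMem_directedLine O 0, hμ.ae_notMem_directedLine O θ] with x hx0 hxθ
    have hne : (x - O).2 ≠ 0 := by
      intro h
      refine hx0 ⟨x.1 - O.1, Prod.ext ?_ ?_⟩
      · simp
      · simp only [Prod.snd_sub] at h
        simp only [Real.sin_zero, Real.cos_zero, Prod.snd_add, Prod.smul_mk, smul_zero]
        linarith
    have hneq : polarAngle (x - O) ≠ θ := by
      rintro rfl
      exact hxθ mem_directedLine_polarAngle
    have hc : ContinuousAt (fun z : (ℝ × ℝ) × ℝ => polarAngle (x - z.1)) (O, θ) :=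
      ContinuousAt.comp (f := fun z : (ℝ × ℝ) × ℝ => x - z.1) (continuousAt_polarAngle hne)
        (by fun_prop)
    have hs : ContinuousAt (fun z : (ℝ × ℝ) × ℝ => z.2) (O, θ) := by fun_prop
    rcases hneq.lt_or_gt with h | h
    · refine (continuousAt_const (y := (1 : ℝ))).congr ?_
      filter_upwards [hc.eventually_lt hs h] with z hz
      rw [Set.indicator_of_mem]
      exact hz.le
    · refine (continuousAt_const (y := (0 : ℝ))).congr ?_
      filter_upwards [hs.eventually_lt hc h] with z hz
      rw [Set.indicator_of_notMem]
      exact not_le.2 hz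

lemma IsMass.measureReal_wedge {μ : Measure (ℝ × ℝ)} (hμ : IsMass μ) (O : ℝ × ℝ) {α β : ℝ}
    (h0 : 0 ≤ α) (h1 : α ≤ β) (h2 : β ≤ 2 * Real.pi) :
    μ.real (Wedge O α β) = angularMass μ O β - angularMass μ O α := by
  have := hμ.1
  rw [angularMass_sub μ O h1]
  refine measureReal_congr ?_
  filter_upwards [hμ.ae_notMem_directedLine O α] with x hx
  refine propext ⟨?_, ?_⟩
  · rintro (rfl | ⟨r, hr, θ, ⟨hθ1, hθ2⟩, rfl⟩)
    · exact absurd (self_mem_directedLine _ _) hx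
    · have hlt : α < θ := lt_of_le_of_ne hθ1 fun e => hx ⟨r, by rw [e]⟩
      change α < polarAngle _ ∧ polarAngle _ ≤ β
      rw [add_sub_cancel_left, polarAngle_smul hr (by linarith) (by linarith)]
      exact ⟨hlt, hθ2⟩
  · rintro ⟨h3, h4⟩
    have hv : x - O ≠ 0 := fun h => hx (by rw [sub_eq_zero.1 h]; exact self_mem_directedLine _ _)
    obtain ⟨r, hr, hv'⟩ := exists_eq_smul_polarAngle hv
    exact Or.inr ⟨r, hr, _, ⟨h3.le, h4⟩, by rw [← hv']; abel⟩

lemma IsMass.measureReal_wedge_add_two_pi {μ : Measure (ℝ × ℝ)} (hμ : IsMass μ) (O : ℝ × ℝ)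
    {α β : ℝ} (h0 : 0 ≤ β) (h1 : β ≤ α) (h2 : α ≤ 2 * Real.pi) :
    μ.real (Wedge O α (β + 2 * Real.pi)) = angularMass μ O β + (1 - angularMass μ O α) := by
  have := hμ.1
  have hpi := Real.pi_pos
  have hdisj : Disjoint {x | polarAngle (x - O) ≤ β} {x | α < polarAngle (x - O)} :=
    Set.disjoint_left.2 fun x hx hx' => by
      simp only [Set.mem_ofPred_eq] at hx hx'
      linarith
  rw [one_sub_angularMass, angularMass, ← measureReal_union hdisj
    (measurableSet_lt measurable_const (measurable_polarAngle_sub O))]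
  refine measureReal_congr ?_
  filter_upwards [hμ.ae_notMem_directedLine O α] with x hx
  refine propext ⟨?_, ?_⟩
  · rintro (rfl | ⟨r, hr, θ, ⟨hθ1, hθ2⟩, rfl⟩)
    · exact absurd (self_mem_directedLine _ _) hx
    · have hlt : α < θ := lt_of_le_of_ne hθ1 fun e => hx ⟨r, by rw [e]⟩
      rcases le_or_gt θ (2 * Real.pi) with h | h
      · right
        change α < polarAngle _
        rwa [add_sub_cancel_left, polarAngle_smul hr (by linarith) h]
      · left
        change polarAngle _ ≤ β
        rw [add_sub_cancel_left, ← Real.cos_sub_two_pi, ← Real.sin_sub_two_pi,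
          polarAngle_smul hr (by linarith) (by linarith)]
        linarith
  · intro h
    have hv : x - O ≠ 0 := fun h => hx (by rw [sub_eq_zero.1 h]; exact self_mem_directedLine _ _)
    obtain ⟨r, hr, hv'⟩ := exists_eq_smul_polarAngle hv
    have hp0 := polarAngle_pos (x - O)
    have hp1 := polarAngle_le (x - O)
    rcases h with h | h
    · simp only [Set.mem_ofPred_eq] at h
      refine Or.inr ⟨r, hr, polarAngle (x - O) + 2 * Real.pi, ⟨by linarith, by linarith⟩, ?_⟩
      rw [Real.cos_add_two_pi, Real.sin_add_two_pi, ← hv']; abel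
    · exact Or.inr ⟨r, hr, _, ⟨le_of_lt h, by linarith⟩, by rw [← hv']; abel⟩

lemma wedge_add_two_pi_mul (O : ℝ × ℝ) (α β : ℝ) (n : ℤ) :
    Wedge O (α + 2 * Real.pi * n) (β + 2 * Real.pi * n) = Wedge O α β := by
  unfold Wedge
  congr 1
  ext x
  constructor
  · rintro ⟨r, hr, θ, ⟨h1, h2⟩, rfl⟩
    refine ⟨r, hr, θ - n * (2 * Real.pi), ⟨by linarith, by linarith⟩, ?_⟩
    rw [Real.cos_sub_int_mul_two_pi, Real.sin_sub_int_mul_two_pi]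
  · rintro ⟨r, hr, θ, ⟨h1, h2⟩, rfl⟩
    refine ⟨r, hr, θ + n * (2 * Real.pi), ⟨by linarith, by linarith⟩, ?_⟩
    rw [Real.cos_add_int_mul_two_pi, Real.sin_add_int_mul_two_pi]

lemma exists_angle_of_add_smul {r s φ ψ : ℝ} (hr : 0 < r) (hs : 0 < s) (h : φ ≤ ψ)
    (h' : ψ ≤ φ + Real.pi) :
    ∃ ρ : ℝ, 0 ≤ ρ ∧ ∃ χ ∈ Set.Icc φ ψ,
      r • (Real.cos φ, Real.sin φ) + s • (Real.cos ψ, Real.sin ψ) =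
        ρ • (Real.cos χ, Real.sin χ) := by
  have hpi := Real.pi_pos
  set z : ℂ := ⟨r + s * Real.cos (ψ - φ), s * Real.sin (ψ - φ)⟩ with hz
  have h1 : ‖z‖ * Real.cos z.arg = r + s * Real.cos (ψ - φ) := Complex.norm_mul_cos_arg z
  have h2 : ‖z‖ * Real.sin z.arg = s * Real.sin (ψ - φ) := Complex.norm_mul_sin_arg z
  have hsin : 0 ≤ Real.sin (ψ - φ) := Real.sin_nonneg_of_nonneg_of_le_pi (by linarith) (by linarith)
  have key : ∀ χ, ‖z‖ * Real.cos (χ - φ) = r + s * Real.cos (ψ - φ) →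
      ‖z‖ * Real.sin (χ - φ) = s * Real.sin (ψ - φ) →
      r • (Real.cos φ, Real.sin φ) + s • (Real.cos ψ, Real.sin ψ) =
        ‖z‖ • (Real.cos χ, Real.sin χ) := by
    intro χ k1 k2
    have c1 : Real.cos χ = Real.cos (χ - φ) * Real.cos φ - Real.sin (χ - φ) * Real.sin φ := by
      rw [← Real.cos_add]; ring_nf
    have c2 : Real.sin χ = Real.sin (χ - φ) * Real.cos φ + Real.cos (χ - φ) * Real.sin φ := by
      rw [← Real.sin_add]; ring_nf
    have c3 : Real.cos ψ = Real.cos (ψ - φ) * Real.cos φ - Real.sin (ψ - φ) * Real.sin φ := by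
      rw [← Real.cos_add]; ring_nf
    have c4 : Real.sin ψ = Real.sin (ψ - φ) * Real.cos φ + Real.cos (ψ - φ) * Real.sin φ := by
      rw [← Real.sin_add]; ring_nf
    apply Prod.ext
    · simp only [Prod.smul_mk, smul_eq_mul, Prod.mk_add_mk]
      rw [c1, c3]
      linear_combination Real.sin φ * k2 - Real.cos φ * k1
    · simp only [Prod.smul_mk, smul_eq_mul, Prod.mk_add_mk]
      rw [c2, c4]
      linear_combination -Real.cos φ * k2 - Real.sin φ * k1
  by_cases hz0 : z = 0
  · rw [hz0, norm_zero] at h1 h2 key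
    exact ⟨0, le_rfl, φ, ⟨le_rfl, h⟩, key φ (by simpa using h1) (by simpa using h2)⟩
  refine ⟨‖z‖, norm_nonneg _, φ + z.arg, ⟨?_, ?_⟩, key _ (by simpa using h1) (by simpa using h2)⟩
  · have : 0 ≤ z.arg := Complex.arg_nonneg_iff.2 (mul_nonneg hs.le hsin)
    linarith
  · by_contra! hlt
    have hnorm : 0 < ‖z‖ := norm_pos_iff.2 hz0
    have harg := Complex.arg_le_pi z
    have e : ‖z‖ * Real.sin (z.arg - (ψ - φ)) = -(r * Real.sin (ψ - φ)) := by
      rw [Real.sin_sub]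
      linear_combination Real.cos (ψ - φ) * h2 - Real.sin (ψ - φ) * h1
    have e1 : 0 ≤ Real.sin (z.arg - (ψ - φ)) :=
      Real.sin_nonneg_of_nonneg_of_le_pi (by linarith) (by linarith)
    have e2 : Real.sin (z.arg - (ψ - φ)) = 0 := by
      refine le_antisymm ?_ e1
      by_contra! h3
      have := mul_pos hnorm h3
      have := mul_nonneg hr.le hsin
      linarith
    have e3 : z.arg - (ψ - φ) = Real.pi := by
      by_contra h3
      have := Real.sin_pos_of_pos_of_lt_pi (x := z.arg - (ψ - φ)) (by linarith)
        (lt_of_le_of_ne (by linarith) h3)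
      linarith
    have e4 : ψ - φ = 0 := by linarith
    have e5 : z.arg = Real.pi := by linarith
    rw [e4, e5, Real.cos_pi, Real.cos_zero] at h1
    linarith

lemma convex_wedge (O : ℝ × ℝ) {α β : ℝ} (h : β - α ≤ Real.pi) : Convex ℝ (Wedge O α β) := by
  have hadd : ∀ {r s φ ψ : ℝ}, 0 < r → 0 < s → φ ∈ Set.Icc α β → ψ ∈ Set.Icc α β →
      O + (r • (Real.cos φ, Real.sin φ) + s • (Real.cos ψ, Real.sin ψ)) ∈ Wedge O α β := by
    intro r s φ ψ hr hs hφ hψ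
    wlog hle : φ ≤ ψ generalizing r s φ ψ
    · rw [add_comm (r • _)]
      exact this hs hr hψ hφ (le_of_not_ge hle)
    obtain ⟨ρ, hρ, χ, hχ, e⟩ := exists_angle_of_add_smul hr hs hle
      (by linarith [hφ.1, hψ.2])
    rw [e]
    rcases hρ.eq_or_lt with rfl | hρ
    · left; simp
    · exact Or.inr ⟨ρ, hρ, χ, ⟨hφ.1.trans hχ.1, hχ.2.trans hψ.2⟩, rfl⟩
  refine convex_iff_forall_pos.2 ?_
  rintro x (rfl | ⟨r, hr, φ, hφ, rfl⟩) y (rfl | ⟨s, hs, ψ, hψ, rfl⟩) a b ha hb hab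
  · left; rw [← add_smul, hab, one_smul]; rfl
  · refine Or.inr ⟨b * s, by positivity, ψ, hψ, ?_⟩
    rw [smul_add, ← add_assoc, ← add_smul, hab, one_smul, smul_smul]
  · refine Or.inr ⟨a * r, by positivity, φ, hφ, ?_⟩
    rw [smul_add, add_right_comm, ← add_smul, hab, one_smul, smul_smul]
  · have := hadd (mul_pos ha hr) (mul_pos hb hs) hφ hψ
    rwa [mul_smul, mul_smul, show O + (a • r • (Real.cos φ, Real.sin φ) +
      b • s • (Real.cos ψ, Real.sin ψ)) = a • (O + r • (Real.cos φ, Real.sin φ)) +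
      b • (O + s • (Real.cos ψ, Real.sin ψ)) by
        rw [smul_add, smul_add, add_add_add_comm, ← add_smul, hab, one_smul]] at this

lemma exists_measureReal_compl_centeredSquare_le (μ : Measure (ℝ × ℝ)) [IsProbabilityMeasure μ]
    {δ : ℝ} (hδ : 0 < δ) : ∃ r : ℝ, 0 < r ∧ μ.real (centeredSquare r)ᶜ ≤ δ := by
  obtain ⟨K, -, hK, hlt⟩ := MeasurableSet.univ.exists_isCompact_sdiff_lt (measure_ne_top μ _)
    (ENNReal.ofReal_pos.2 hδ).ne'
  obtain ⟨r, hr⟩ := hK.isBounded.subset_closedBall 0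
  refine ⟨max r 1, by positivity, ?_⟩
  have hsub : (centeredSquare (max r 1))ᶜ ⊆ Set.univ \ K := by
    rw [← Set.compl_eq_univ_sdiff, Set.compl_subset_compl]
    intro x hx
    have h := hr hx
    rw [mem_closedBall_zero_iff, Prod.norm_def, max_le_iff, Real.norm_eq_abs, Real.norm_eq_abs,
      abs_le, abs_le] at h
    have := le_max_left r 1
    exact ⟨⟨by linarith [h.1.1], by linarith [h.1.2]⟩, ⟨by linarith [h.2.1], by linarith [h.2.2]⟩⟩
  rw [measureReal_def]
  exact ENNReal.toReal_le_of_le_ofReal hδ.le ((measure_mono hsub).trans hlt.le)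

lemma pi_lt_polarAngle {v : ℝ × ℝ} (hv : v.2 < 0) : Real.pi < polarAngle v := by
  have h0 : 0 ≤ Complex.arg ⟨-v.1, -v.2⟩ := Complex.arg_nonneg_iff.2 (by simpa using hv.le)
  have h1 : Complex.arg ⟨-v.1, -v.2⟩ ≠ 0 := fun h => by
    have := (Complex.arg_eq_zero_iff.1 h).2
    simp only [neg_eq_zero] at this
    exact hv.ne this
  have := h0.lt_of_ne' h1
  unfold polarAngle; linarith

lemma polarAngle_lt_pi {v : ℝ × ℝ} (hv : 0 < v.2) : polarAngle v < Real.pi := by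
  have := Complex.arg_neg_iff (z := ⟨-v.1, -v.2⟩).2 (by simpa using hv)
  unfold polarAngle; linarith

lemma polarAngle_mem_Ioo_of_fst_neg {v : ℝ × ℝ} (hv : v.1 < 0) :
    polarAngle v ∈ Set.Ioo (Real.pi / 2) (3 * Real.pi / 2) := by
  have := abs_lt.1 (Complex.abs_arg_lt_pi_div_two_iff (z := ⟨-v.1, -v.2⟩).2
    (Or.inl (by simpa using hv)))
  unfold polarAngle
  exact ⟨by linarith, by linarith⟩

lemma polarAngle_notMem_Icc_of_fst_pos {v : ℝ × ℝ} (hv : 0 < v.1) :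
    polarAngle v ∉ Set.Icc (Real.pi / 2) (3 * Real.pi / 2) := by
  rintro ⟨h1, h2⟩
  unfold polarAngle at h1 h2
  have := Complex.abs_arg_le_pi_div_two_iff (z := ⟨-v.1, -v.2⟩).1
    (abs_le.2 ⟨by linarith, by linarith⟩)
  simp only at this
  linarith

/-- A mixture of the angular mass with the uniform distribution of angles, which makes the
distribution function strictly increasing. -/
def regularizedMass (μ : Measure (ℝ × ℝ)) (ε : ℝ) (O : ℝ × ℝ) (θ : ℝ) : ℝ :=
  (1 - ε) * angularMass μ O θ + ε * (θ / (2 * Real.pi))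

/-- The triples consisting of a regularisation parameter, an apex and an angle sequence of a
spiral equicovering for the corresponding regularised mass. -/
def regularizedEquicoverings (μ : Measure (ℝ × ℝ)) (q p : ℕ) :
    Set (ℝ × (ℝ × ℝ) × (ℤ → ℝ)) :=
  {z | (∀ j : ℤ, z.2.2 (j + q) = z.2.2 j + 2 * Real.pi) ∧ (∀ j : ℤ, z.2.2 j ≤ z.2.2 (j + 1)) ∧
    z.2.2 0 = 0 ∧
    (∀ j : ℤ, 0 ≤ j → j ≤ q → regularizedMass μ z.1 z.2.1 (z.2.2 j) = j / q) ∧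
    ∀ k : ℤ, z.2.2 (k + p) - z.2.2 k ≤ Real.pi}

lemma isClosed_setOf_forall {X : Type*} [TopologicalSpace X] {ι : Sort*} {P : ι → X → Prop}
    (h : ∀ i, IsClosed {x | P i x}) : IsClosed {x | ∀ i, P i x} := by
  rw [Set.ofPred_forall]
  exact isClosed_iInter h

lemma IsMass.isClosed_regularizedEquicoverings {μ : Measure (ℝ × ℝ)} (hμ : IsMass μ) (q p : ℕ) :
    IsClosed (regularizedEquicoverings μ q p) := by
  have happ : ∀ j : ℤ, Continuous fun z : ℝ × (ℝ × ℝ) × (ℤ → ℝ) => z.2.2 j := fun j =>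
    (continuous_apply j).comp (continuous_snd.comp continuous_snd)
  have hreg : ∀ j : ℤ, Continuous fun z : ℝ × (ℝ × ℝ) × (ℤ → ℝ) =>
      regularizedMass μ z.1 z.2.1 (z.2.2 j) := fun j => by
    have h1 := hμ.continuous_angularMass.comp
      ((continuous_fst.comp continuous_snd).prodMk (happ j))
    have h2 := happ j
    have h3 : Continuous fun z : ℝ × (ℝ × ℝ) × (ℤ → ℝ) => angularMass μ z.2.1 (z.2.2 j) := h1
    unfold regularizedMass
    fun_prop
  refine IsClosed.and (isClosed_setOf_forall fun j => ?_)
    (IsClosed.and (isClosed_setOf_forall fun j => ?_) (IsClosed.and ?_ (IsClosed.and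
      (isClosed_setOf_forall fun j => isClosed_setOf_forall fun _ =>
      isClosed_setOf_forall fun _ => ?_) (isClosed_setOf_forall fun k => ?_))))
  · exact isClosed_eq (happ _) ((happ _).add continuous_const)
  · exact isClosed_le (happ _) (happ _)
  · exact isClosed_eq (happ _) continuous_const
  · exact isClosed_eq (hreg _) continuous_const
  · exact isClosed_le ((happ _).sub (happ _)) continuous_const

lemma IsMass.exists_regularizedEquicovering {μ : Measure (ℝ × ℝ)} (hμ : IsMass μ) {q p : ℕ}
    (hp : 2 ≤ p) (hq : q + 1 = 3 * p) {r R : ℝ} (hr : 0 < r) (hrR : r < R)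
    (hδ : q * μ.real (centeredSquare r)ᶜ ≤ 1 / 16) {ε : ℝ} (hε0 : 0 < ε) (hε : q * ε ≤ 1 / 16) :
    ∃ O ∈ centeredSquare R, ∃ θ : ℤ → ℝ, (ε, O, θ) ∈ regularizedEquicoverings μ q p := by
  have := hμ.1
  have hpi := Real.pi_pos
  have hqpos : (1 : ℝ) ≤ q := by exact_mod_cast (by omega : 1 ≤ q)
  have hε1 : 0 < 1 - ε := by nlinarith
  set δ := μ.real (centeredSquare r)ᶜ with hδ'
  have hδ0 : 0 ≤ δ := measureReal_nonneg
  have inside : ∀ {s : Set (ℝ × ℝ)}, (∀ x ∈ centeredSquare r, x ∉ s) → μ.real s ≤ δ :=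
    fun h => measureReal_mono fun x hx hx' => h x hx' hx
  have scale : ∀ a : ℝ, a ≤ δ → (1 - ε) * a ≤ δ := fun a ha => by nlinarith
  have m0 := angularMass_zero μ
  have m1 := angularMass_two_pi μ
  obtain ⟨O, hO, θ, h1, h2, h3, h4, h5⟩ := exists_convex_of_angular_distribution hp hq
    (hr.trans hrR) (G := regularizedMass μ ε) (by
      have h := hμ.continuous_angularMass
      unfold regularizedMass
      fun_prop)
    (fun O a b hab => add_lt_add_of_le_of_lt
      (mul_le_mul_of_nonneg_left (angularMass_mono μ O hab.le) hε1.le)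
      (mul_lt_mul_of_pos_left (div_lt_div_of_pos_right hab (by positivity)) hε0))
    (fun O => by simp [regularizedMass, m0])
    (fun O => by
      rw [regularizedMass, m1, div_self (by positivity)]; ring)
    (fun O hO => by
      have h : angularMass μ O Real.pi ≤ δ := inside fun x hx hx' =>
        not_lt.2 hx' (pi_lt_polarAngle (by
          have := hx.2.2
          simp only [Prod.snd_sub]; linarith))
      have h' := scale _ h
      have e : ε * (Real.pi / (2 * Real.pi)) = ε / 2 := by field_simp
      rw [regularizedMass, e]
      nlinarith)
    (fun O hO => by
      have h : 1 - angularMass μ O Real.pi ≤ δ := by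
        rw [one_sub_angularMass]
        exact inside fun x hx hx' => lt_asymm hx' (polarAngle_lt_pi (by
          have := hx.2.1
          simp only [Prod.snd_sub]; linarith))
      have h' := scale _ h
      have e : ε * (Real.pi / (2 * Real.pi)) = ε / 2 := by field_simp
      rw [regularizedMass, e]
      nlinarith)
    (fun O hO => by
      have hmem : ∀ x ∈ centeredSquare r,
          polarAngle (x - O) ∈ Set.Ioo (Real.pi / 2) (3 * Real.pi / 2) := fun x hx =>
        polarAngle_mem_Ioo_of_fst_neg (by
          have := hx.1.2
          simp only [Prod.fst_sub]; linarith)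
      have h : angularMass μ O (Real.pi / 2) ≤ δ := inside fun x hx hx' =>
        not_lt.2 hx' (hmem x hx).1
      have h2 : 1 - angularMass μ O (3 * Real.pi / 2) ≤ δ := by
        rw [one_sub_angularMass]
        exact inside fun x hx hx' => lt_asymm hx' (hmem x hx).2
      have h' := scale _ h
      have h2' := scale _ h2
      have e : ε * (Real.pi / 2 / (2 * Real.pi)) = ε / 4 := by field_simp; norm_num
      have e2 : ε * (3 * Real.pi / 2 / (2 * Real.pi)) = 3 * ε / 4 := by field_simp; norm_num
      rw [regularizedMass, regularizedMass, e, e2]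
      constructor <;> nlinarith)
    (fun O hO => by
      have h : angularMass μ O (3 * Real.pi / 2) - angularMass μ O (Real.pi / 2) ≤ δ := by
        rw [angularMass_sub μ O (by linarith)]
        exact inside fun x hx hx' => polarAngle_notMem_Icc_of_fst_pos (v := x - O) (by
          have := hx.1.1
          simp only [Prod.fst_sub]; linarith) ⟨hx'.1.le, hx'.2⟩
      have h' := scale _ h
      have e : ε * (Real.pi / 2 / (2 * Real.pi)) = ε / 4 := by field_simp; norm_num
      have e2 : ε * (3 * Real.pi / 2 / (2 * Real.pi)) = 3 * ε / 4 := by field_simp; norm_num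
      rw [regularizedMass, regularizedMass, e, e2]
      nlinarith)
  exact ⟨O, hO, θ, h1, fun j => h2 (by omega), h3, h4, h5⟩

lemma IsMass.exists_mem_regularizedEquicoverings_zero {μ : Measure (ℝ × ℝ)} (hμ : IsMass μ)
    {q p : ℕ} (hp : 2 ≤ p) (hq : q + 1 = 3 * p) :
    ∃ (O : ℝ × ℝ) (θ : ℤ → ℝ), (0, O, θ) ∈ regularizedEquicoverings μ q p := by
  have := hμ.1
  have hqpos : (0 : ℝ) < q := by exact_mod_cast (by omega : 0 < q)
  obtain ⟨r, hr, hδ⟩ := exists_measureReal_compl_centeredSquare_le μ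
    (by positivity : 0 < 1 / 16 / (q : ℝ))
  rw [le_div_iff₀' hqpos] at hδ
  let B : Set (ℝ × (ℝ × ℝ) × (ℤ → ℝ)) := Set.Icc 0 1 ×ˢ centeredSquare (r + 1) ×ˢ
    Set.univ.pi fun j : ℤ => Set.Icc (2 * Real.pi * (j / (q : ℤ) : ℤ))
      (2 * Real.pi * (j / (q : ℤ) : ℤ) + 2 * Real.pi)
  have hB : IsCompact B := isCompact_Icc.prod ((isCompact_Icc.prod isCompact_Icc).prod
    (isCompact_univ_pi fun _ => isCompact_Icc))
  have hclosed : IsClosed (Prod.fst '' (B ∩ regularizedEquicoverings μ q p)) :=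
    ((hB.inter_right (hμ.isClosed_regularizedEquicoverings q p)).image continuous_fst).isClosed
  have hsub : Set.Ioo 0 (1 / 16 / (q : ℝ)) ⊆ Prod.fst '' (B ∩ regularizedEquicoverings μ q p) := by
    rintro ε ⟨hε0, hε⟩
    have hε1 : q * ε ≤ 1 / 16 := by rw [← le_div_iff₀' hqpos]; exact hε.le
    obtain ⟨O, hO, θ, h⟩ := hμ.exists_regularizedEquicovering hp hq hr (lt_add_one r) hδ hε0 hε1
    refine ⟨(ε, O, θ), ⟨⟨⟨hε0.le, ?_⟩, hO, fun j _ => ?_⟩, h⟩, rfl⟩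
    · have : (1 : ℝ) ≤ q := by exact_mod_cast (by omega : 1 ≤ q)
      change ε ≤ 1
      nlinarith
    · obtain ⟨h1, h2, h3, -, -⟩ := h
      simp only at h1 h2 h3
      have hm : Monotone θ := monotone_int_of_le_succ h2
      have e := Int.emod_add_mul_ediv j q
      have l1 := hm (Int.emod_nonneg j (by omega) : 0 ≤ j % q)
      have l2 := hm (Int.emod_lt_of_pos j (by omega) : j % q < q).le
      have k1 := add_int_mul_of_add h1 (j % q) (j / q)
      have k2 := h1 0
      rw [zero_add, h3, zero_add] at k2
      rw [show j % q + j / q * q = j by linear_combination e] at k1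
      change _ ≤ θ j ∧ θ j ≤ _
      constructor <;> linarith
  have h0 : (0 : ℝ) ∈ closure (Set.Ioo 0 (1 / 16 / (q : ℝ))) := by
    have hpos : (0 : ℝ) < 1 / 16 / q := by positivity
    rw [closure_Ioo hpos.ne]
    exact ⟨le_rfl, hpos.le⟩
  obtain ⟨⟨ε, O, θ⟩, ⟨-, h⟩, rfl⟩ := closure_minimal hsub hclosed h0
  exact ⟨O, θ, h⟩

/-- If `p ≥ 2` and `q = 3p - 1`, every mass admits a `(q,p)`-spiral equicovering. -/
theorem spiral_equicovering_of_q_eq_three_p_sub_one (p q : ℕ) (hp : 2 ≤ p)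
    (hq : q + 1 = 3 * p) :
    ∀ μ : Measure (ℝ × ℝ), IsMass μ → IsSpiralEquicovering μ q p := by
  intro μ hμ
  have := hμ.1
  have hqpos : (0 : ℝ) < q := by exact_mod_cast (by omega : 0 < q)
  obtain ⟨O, θ, hθ, hmono, h0, hlevel, hconv⟩ :=
    hμ.exists_mem_regularizedEquicoverings_zero hp hq
  simp only [regularizedMass, sub_zero, one_mul, zero_mul, add_zero] at hθ hmono h0 hlevel hconv
  refine ⟨O, θ, hθ, hmono, fun i => ⟨convex_wedge O (hconv i), ?_⟩⟩
  have hm : Monotone θ := monotone_int_of_le_succ hmono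
  have hq2 : θ q = 2 * Real.pi := by
    have := hθ 0
    rwa [zero_add, h0, zero_add] at this
  have e := Int.emod_add_mul_ediv i q
  have l1 : 0 ≤ i % q := Int.emod_nonneg _ (by omega)
  have l2 : i % q < q := Int.emod_lt_of_pos _ (by omega)
  have k1 := add_int_mul_of_add hθ (i % q) (i / q)
  have k2 := add_int_mul_of_add hθ (i % q + p) (i / q)
  rw [show i % q + i / q * q = i by linear_combination e] at k1
  rw [show i % q + p + i / q * q = i + p by linear_combination e] at k2
  rw [k1, k2, wedge_add_two_pi_mul]
  generalize i % (q : ℤ) = k at *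
  have hk0 : 0 ≤ θ k := h0 ▸ hm l1
  have hk1 : θ k ≤ 2 * Real.pi := hq2 ▸ hm l2.le
  rw [← ofReal_measureReal]
  congr 1
  rcases le_or_gt (k + p) (q : ℤ) with h | h
  · rw [hμ.measureReal_wedge O hk0 (hm (by omega)) (hq2 ▸ hm h), hlevel _ (by omega) h,
      hlevel _ l1 l2.le]
    push_cast; ring
  · have ew := hθ (k + p - q)
    rw [sub_add_cancel] at ew
    rw [ew, hμ.measureReal_wedge_add_two_pi O (h0 ▸ hm (by omega)) (hm (by omega)) hk1,
      hlevel _ (by omega) (by omega), hlevel _ l1 l2.le]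
    push_cast
    field_simp; ring
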